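/- Let X be a measurable space, n a natural number, and A : Fin n → Set X a family of measurable sets. For each i, let μ i be a finite measure on X supported on A i (i.e., (μ i).restrict (A i) = μ i), and assume that for all i, j, (μ i).restrict (A i ∩ A j) = (μ j).restrict (A i ∩ A j). Then the unique measure μ supported on ⋃ i, A i with μ.restrict (A i) = μ i for all i is itself finite; moreover μ(⋃ i, A i) ≤ Σ_i μ_i(A i). -/

import Mathlib

open MeasureTheory

/-- Corollary 3.2 (finite_measure_sheaf): the gluing of compatible finite
measures on a finite cover is finite, with total mass at most `Σ_i μ_i(A i)`. -/
theorem finite_measure_sheaf {X : Type*} [MeasurableSpace X]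
    (n : ℕ) (A : Fin n → Set X) (hA : ∀ i, MeasurableSet (A i))
    (μ : Fin n → Measure X) (hfin : ∀ i, IsFiniteMeasure (μ i))
    (hsupp : ∀ i, (μ i).restrict (A i) = μ i)
    (hcompat : ∀ i j, (μ i).restrict (A i ∩ A j) = (μ j).restrict (A i ∩ A j)) :
    ∀ ν : Measure X, ν.restrict (⋃ i, A i) = ν → (∀ i, ν.restrict (A i) = μ i) →
      IsFiniteMeasure ν ∧ ν (⋃ i, A i) ≤ ∑ i, μ i (A i) := by
  intro ν hν hres
  have hle : ν (⋃ i, A i) ≤ ∑ i, μ i (A i) := by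
    refine (measure_iUnion_fintype_le ν A).trans (Finset.sum_le_sum fun i _ => ?_)
    rw [← hres i, Measure.restrict_apply_self]
  refine ⟨⟨?_⟩, hle⟩
  rw [← hν, Measure.restrict_apply_univ]
  exact hle.trans_lt (ENNReal.sum_lt_top.2 fun i _ => measure_lt_top (μ i) (A i))
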